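/- arXiv:2508.17790 — 6 statements merged into one kernel-verified Lean document; each statement's English description precedes it below -/
import Mathlib

section
/- Let k be a field of characteristic 5. There is no polynomial φ ∈ k[t] and no nonzero c ∈ k such that the formal derivative of φ equals c · t^3 · (t−1)^2. -/
open Polynomial

theorem stmt_3 (k : Type*) [Field k] [CharP k 5] :
    ¬ ∃ (φ : k[X]) (c : k), c ≠ 0 ∧
      derivative φ = C c * (X ^ 3 * (X - 1) ^ 2) := by
  rintro ⟨φ, c, hc, h⟩
  have h5 : (5 : k) = 0 := by exact_mod_cast CharP.cast_eq_zero k 5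
  have e : C c * (X ^ 3 * (X - 1) ^ 2) = C c * X ^ 5 + C (-2 * c) * X ^ 4 + C c * X ^ 3 := by
    simp only [C_mul, C_neg, map_ofNat]
    ring
  rw [e] at h
  have h4 := congrArg (fun p => coeff p 4) h
  simp only [coeff_derivative, coeff_add, coeff_C_mul, coeff_X_pow] at h4
  norm_num at h4
  rw [h5, mul_zero] at h4
  apply hc
  have h2 : 2 * c = 0 := by linear_combination h4
  linear_combination (-2) * h2 + c * h5
end

section
/- Let k be a field of characteristic 5, let g ∈ k[t] be a polynomial of degree 5, and let y ∈ k[t] be a polynomial of degree at most 10 satisfying 2·y·y′ = g^3, where y′ is the formal derivative. Then either deg y = 8 and deg y′ = 7, or deg y = 10 and deg y′ = 5. -/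
open Polynomial

theorem stmt_8 (k : Type*) [Field k] [CharP k 5] (g y : k[X])
    (hg : g.degree = 5) (hy : y.degree ≤ 10)
    (h : 2 * (y * derivative y) = g ^ 3) :
    (y.degree = 8 ∧ (derivative y).degree = 7) ∨
    (y.degree = 10 ∧ (derivative y).degree = 5) := by
  have hg0 : g ≠ 0 := by
    rintro rfl
    simp at hg
  have hne : 2 * (y * derivative y) ≠ 0 := by
    rw [h]
    exact pow_ne_zero 3 hg0
  have h2 : (2 : k[X]) ≠ 0 := left_ne_zero_of_mul hne
  have hy0 : y ≠ 0 := left_ne_zero_of_mul (right_ne_zero_of_mul hne)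
  have hd0 : derivative y ≠ 0 := right_ne_zero_of_mul (right_ne_zero_of_mul hne)
  have hgn : g.natDegree = 5 := natDegree_eq_of_degree_eq_some hg
  have hyn : y.natDegree ≤ 10 := natDegree_le_of_degree_le hy
  have hsum : y.natDegree + (derivative y).natDegree = 15 := by
    have e := congrArg natDegree h
    rw [natDegree_mul h2 (mul_ne_zero hy0 hd0), natDegree_mul hy0 hd0, natDegree_pow, hgn,
      natDegree_ofNat] at e
    omega
  have hlt : (derivative y).natDegree ≤ y.natDegree - 1 := natDegree_derivative_le y
  have h9 : y.natDegree ≠ 9 := by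
    intro h9
    have hc : (derivative y).coeff 8 = 0 := coeff_eq_zero_of_natDegree_lt (by omega)
    rw [coeff_derivative] at hc
    have hl : y.coeff 9 ≠ 0 := by
      rw [← h9]
      exact leadingCoeff_ne_zero.mpr hy0
    have h9k : ((9 : ℕ) : k) ≠ 0 := by
      rw [Ne, CharP.cast_eq_zero_iff k 5]
      norm_num
    apply mul_ne_zero hl h9k
    rw [← hc]
    norm_num
  rw [degree_eq_natDegree hy0, degree_eq_natDegree hd0]
  have hcases : (y.natDegree = 8 ∧ (derivative y).natDegree = 7) ∨
      (y.natDegree = 10 ∧ (derivative y).natDegree = 5) := by omega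
  rcases hcases with ⟨a, b⟩ | ⟨a, b⟩
  · left
    rw [a, b]
    exact ⟨rfl, rfl⟩
  · right
    rw [a, b]
    exact ⟨rfl, rfl⟩
end

section
/- Let k be an algebraically closed field of characteristic 5, let α1,…,α5 ∈ k be pairwise distinct, and set g = (t−α1)(t−α2)(t−α3)(t−α4)(t−α5) ∈ k[t]. If y ∈ k[t] has degree 10 and satisfies 2·y·y′ = g^3, then there exists a nonzero c ∈ k with y = c·g^2, the formal derivative g′ is the nonzero constant (4c^2)^{-1}, and consequently g = t^5 + a·t + b with a = (4c^2)^{-1} ≠ 0 and some b ∈ k. -/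
open Polynomial

theorem stmt_9 (k : Type*) [Field k] [IsAlgClosed k] [CharP k 5]
    (α : Fin 5 → k) (hα : Function.Injective α)
    (g : k[X]) (hg : g = ∏ i, (X - C (α i)))
    (y : k[X]) (hy : y.degree = 10)
    (h : 2 * (y * derivative y) = g ^ 3) :
    ∃ c : k, c ≠ 0 ∧ y = C c * g ^ 2 ∧
      derivative g = C ((4 * c ^ 2)⁻¹) ∧ (4 * c ^ 2)⁻¹ ≠ 0 ∧
      ∃ b : k, g = X ^ 5 + C ((4 * c ^ 2)⁻¹) * X + C b := by
  classical
  have cast_ne : ∀ n : ℕ, ¬ 5 ∣ n → (n : k) ≠ 0 := fun n hn h0 =>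
    hn ((CharP.cast_eq_zero_iff k 5 n).1 h0)
  have h2 : (2 : k) ≠ 0 := by exact_mod_cast cast_ne 2 (by norm_num)
  have h4 : (4 : k) ≠ 0 := by exact_mod_cast cast_ne 4 (by norm_num)
  have h5 : (5 : k) = 0 := by exact_mod_cast CharP.cast_eq_zero k 5
  have hgm : g.Monic := by rw [hg]; exact monic_prod_X_sub_C _ _
  have hg0 : g ≠ 0 := hgm.ne_zero
  have hgd : g.natDegree = 5 := by
    rw [hg, natDegree_prod_of_monic _ _ (fun i _ => monic_X_sub_C _)]; simp
  have hy0 : y ≠ 0 := by rintro rfl; simp at hy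
  have hyd : y.natDegree = 10 := natDegree_eq_of_degree_eq_some hy
  have hroots : g.roots = Finset.univ.val.map α := by
    have := roots_multiset_prod_X_sub_C (Finset.univ.val.map α)
    rw [Multiset.map_map] at this
    rw [hg]; exact this
  have hnd : g.roots.Nodup := by
    rw [hroots]; exact Finset.univ.nodup.map hα
  have hdvd : y.roots ≤ (g ^ 2).roots := by
    rw [Multiset.le_iff_count]
    intro a
    rw [roots_pow, Multiset.count_nsmul]
    have h1 : g.roots.count a ≤ 1 := Multiset.nodup_iff_count_le_one.1 hnd a
    have hne : y * derivative y ≠ 0 := by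
      intro h0; rw [h0, mul_zero] at h; exact pow_ne_zero 3 hg0 h.symm
    have e : (g ^ 3).roots = y.roots + (derivative y).roots := by
      rw [← h, ← roots_mul hne]
      have : (2 : k[X]) = C 2 := (map_ofNat C 2).symm
      rw [this, roots_C_mul _ h2]
    have e2 := congrArg (Multiset.count a) e
    rw [roots_pow, Multiset.count_nsmul, Multiset.count_add] at e2
    have e3 : y.roots.count a - 1 ≤ (derivative y).roots.count a := by
      rw [count_roots, count_roots]
      exact rootMultiplicity_sub_one_le_derivative_rootMultiplicity_of_ne_zero _ _
        (right_ne_zero_of_mul hne)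
    omega
  have hyg : y ∣ g ^ 2 := 
    (IsAlgClosed.splits y).dvd_of_roots_le_roots hy0 hdvd
  obtain ⟨q, hq⟩ := hyg
  have hq0 : q ≠ 0 := by
    rintro rfl; rw [mul_zero] at hq; exact pow_ne_zero 2 hg0 hq
  have hqd : q.natDegree = 0 := by
    have := congrArg natDegree hq
    rw [natDegree_pow, natDegree_mul hy0 hq0] at this
    omega
  obtain ⟨d, rfl⟩ := natDegree_eq_zero.1 hqd
  have hd : d ≠ 0 := by rintro rfl; simp at hq0
  have hyc : y = C d⁻¹ * g ^ 2 := by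
    rw [hq, mul_comm y, ← mul_assoc, ← C_mul, inv_mul_cancel₀ hd]; simp
  obtain ⟨c, hc, hyc⟩ : ∃ c : k, c ≠ 0 ∧ y = C c * g ^ 2 := ⟨d⁻¹, inv_ne_zero hd, hyc⟩
  have hcc : 4 * c ^ 2 ≠ 0 := mul_ne_zero h4 (pow_ne_zero 2 hc)
  have hder : derivative g = C ((4 * c ^ 2)⁻¹) := by
    have e : g ^ 3 * (C (4 * c ^ 2) * derivative g) = g ^ 3 * 1 := by
      rw [mul_one]; conv_rhs => rw [← h, hyc]
      simp [derivative_pow]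
      have e4 : (C 4 : k[X]) = 4 := map_ofNat C 4
      have e2 : (C 2 : k[X]) = 2 := map_ofNat C 2
      simp only [e2, e4]
      ring
    have e := mul_left_cancel₀ (pow_ne_zero 3 hg0) e
    have e' : C ((4 * c ^ 2)⁻¹) * (C (4 * c ^ 2) * derivative g) = C ((4 * c ^ 2)⁻¹) := by
      rw [e, mul_one]
    rwa [← mul_assoc, ← C_mul, inv_mul_cancel₀ hcc, C_1, one_mul] at e'
  refine ⟨c, hc, hyc, hder, inv_ne_zero hcc, g.coeff 0, ?_⟩
  have hcf : ∀ n, g.coeff (n+1) * ((n : k) + 1) = if n = 0 then (4 * c ^ 2)⁻¹ else 0 := by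
    intro n; rw [← coeff_derivative, hder, coeff_C]
  have c1 : g.coeff 1 = (4 * c ^ 2)⁻¹ := by simpa using hcf 0
  have cz : ∀ n, n ≠ 0 → ¬ 5 ∣ n + 1 → g.coeff (n+1) = 0 := by
    intro n hn h5
    have := hcf n
    rw [if_neg hn] at this
    refine (mul_eq_zero.1 this).resolve_right ?_
    exact_mod_cast cast_ne _ h5
  have c5 : g.coeff 5 = 1 := by rw [← hgd]; exact hgm
  conv_lhs => rw [g.as_sum_range_C_mul_X_pow, hgd]
  simp [Finset.sum_range_succ, c1, c5, cz 1, cz 2, cz 3]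
  ring
end

section
/- Let k be a field of characteristic 5. The polynomials y ∈ k[t] of degree at most 10 satisfying 2·y·y′ = (t^5 − t)^3, where y′ is the formal derivative, are exactly the following twelve polynomials: y = ±(t^5 − t)^2, and y = ±(∏_{j ∈ {0,1,2,3,4}, j ≠ i} (t − j))^2 for each i ∈ {0,1,2,3,4} (the elements of the prime field F_5 ⊆ k). -/
open Polynomial

theorem aux_five (k : Type*) [Field k] [CharP k 5] : (5 : k[X]) = 0 := by
  have : ((5 : ℕ) : k[X]) = 0 := CharP.cast_eq_zero _ _
  exact_mod_cast this

theorem aux_prod (k : Type*) [Field k] [CharP k 5] :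
    ∏ j ∈ Finset.range 5, (X - C (j : k)) = X ^ 5 - X := by
  have h5 := aux_five k
  simp only [Finset.prod_range_succ, Finset.prod_range_zero, map_natCast]
  push_cast
  linear_combination (-(2 * X ^ 4 - 7 * X ^ 3 + 10 * X ^ 2 - 5 * X)) * h5

theorem aux_pow (k : Type*) [Field k] [CharP k 5] (i : ℕ) :
    (X - C (i : k)) ^ 5 - (X - C (i : k)) = X ^ 5 - X := by
  have : Fact (Nat.Prime 5) := ⟨by norm_num⟩
  have h1 : (X - C (i : k)) ^ 5 = X ^ 5 - (C (i : k)) ^ 5 := sub_pow_char _ _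
  have h2 : (C (i : k)) ^ 5 = C (i : k) := by
    have : ((i : ZMod 5)) ^ 5 = i := ZMod.pow_card _
    have h := congrArg (ZMod.castHom (dvd_refl 5) k) this
    simp only [map_pow, map_natCast] at h
    rw [← C_pow, h]
  rw [h1, h2]; ring

theorem aux_erase (k : Type*) [Field k] [CharP k 5] (i : ℕ) (hi : i ∈ Finset.range 5) :
    ∏ j ∈ (Finset.range 5).erase i, (X - C (j : k)) = (X - C (i : k)) ^ 4 - 1 := by
  have h := Finset.mul_prod_erase (Finset.range 5) (fun j : ℕ => (X - C (j : k))) hi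
  rw [aux_prod, ← aux_pow k i] at h
  apply mul_left_cancel₀ (X_sub_C_ne_zero (i : k))
  rw [h]; ring

theorem aux_sol1 (k : Type*) [Field k] [CharP k 5] :
    2 * ((X ^ 5 - X) ^ 2 * derivative ((X ^ 5 - X : k[X]) ^ 2)) = (X ^ 5 - X) ^ 3 := by
  have h5 := aux_five k
  have hd : derivative (X ^ 5 - X : k[X]) = -1 := by
    rw [derivative_sub, derivative_X, derivative_X_pow, map_natCast]
    push_cast
    linear_combination X ^ 4 * h5
  rw [pow_two, derivative_mul, hd]
  linear_combination (-(X ^ 5 - X) ^ 3) * h5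

theorem aux_sol2 (k : Type*) [Field k] [CharP k 5] (i : ℕ) :
    2 * (((X - C (i : k)) ^ 4 - 1) ^ 2 * derivative (((X - C (i : k)) ^ 4 - 1) ^ 2))
      = (X ^ 5 - X) ^ 3 := by
  have h5 := aux_five k
  have hd : derivative ((X - C (i : k)) ^ 4 - 1) = 4 * (X - C (i : k)) ^ 3 := by
    simp only [derivative_sub, derivative_pow, derivative_X, derivative_natCast, derivative_one, map_natCast]
    push_cast
    ring
  rw [pow_two, derivative_mul, hd, ← aux_pow k i]
  generalize X - C (i : k) = u
  linear_combination (3 * u ^ 3 * (u ^ 4 - 1) ^ 3) * h5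

theorem aux_mult (k : Type*) [Field k] [CharP k 5] (y : k[X])
    (h : 2 * (y * derivative y) = (X ^ 5 - X) ^ 3) (a : k) (ha : y.IsRoot a) :
    y.rootMultiplicity a = 2 ∧ ∃ j ∈ Finset.range 5, (j : k) = a := by
  classical
  have h5 := aux_five k
  have h5k : (5 : k) = 0 := by
    have : ((5 : ℕ) : k) = 0 := CharP.cast_eq_zero _ _
    exact_mod_cast this
  have hP0 : (X ^ 5 - X : k[X]) ≠ 0 := by
    rw [← aux_prod k]
    exact Finset.prod_ne_zero_iff.2 fun j _ => X_sub_C_ne_zero _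
  have hyy : y * derivative y = 3 * (X ^ 5 - X) ^ 3 := by
    linear_combination 3 * h - (y * derivative y) * h5
  have hPa : (X ^ 5 - X : k[X]).IsRoot a := by
    have := congrArg (eval a) h
    rw [IsRoot] at ha ⊢
    rw [eval_mul, eval_mul, ha, eval_pow] at this
    simp only [zero_mul, mul_zero] at this
    exact pow_eq_zero_iff (by norm_num) |>.1 this.symm
  have hd : derivative (X ^ 5 - X : k[X]) = -1 := by
    rw [derivative_sub, derivative_X, derivative_X_pow, map_natCast]
    push_cast
    linear_combination X ^ 4 * h5
  have h1 : (X ^ 5 - X : k[X]).rootMultiplicity a = 1 := by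
    have hpos := (rootMultiplicity_pos hP0).2 hPa
    have hn : ¬ 1 < (X ^ 5 - X : k[X]).rootMultiplicity a := by
      rw [one_lt_rootMultiplicity_iff_isRoot hP0, hd]
      simp [IsRoot]
    omega
  have h2 : ((2 : k)) ≠ 0 := fun h0 => by
    have : (1 : k) = 0 := by linear_combination h5k - 2 * h0
    exact one_ne_zero this
  have hne : 2 * (y * derivative y) ≠ 0 := by rw [h]; exact pow_ne_zero _ hP0
  have hne' := right_ne_zero_of_mul hne
  have hm : y.rootMultiplicity a + (derivative y).rootMultiplicity a = 3 := by
    have e := congrArg (rootMultiplicity a) h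
    have c2 : (2 : k[X]) = C 2 := (map_ofNat C 2).symm
    rw [rootMultiplicity_mul hne, rootMultiplicity_mul hne', c2, rootMultiplicity_C] at e
    have e3 : ((X ^ 5 - X : k[X]) ^ 3).rootMultiplicity a = 3 := by
      rw [← count_roots, roots_pow, Multiset.count_nsmul, count_roots, h1]
    omega
  have hpos := (rootMultiplicity_pos (left_ne_zero_of_mul hne')).2 ha
  refine ⟨?_, ?_⟩
  · have := derivative_rootMultiplicity_of_root_of_mem_nonZeroDivisors ha (by
      rw [mem_nonZeroDivisors_iff_ne_zero, Ne, CharP.cast_eq_zero_iff k 5]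
      intro hdvd
      have := Nat.le_of_dvd hpos hdvd
      omega)
    omega
  · rw [← aux_prod k, IsRoot, eval_prod, Finset.prod_eq_zero_iff] at hPa
    obtain ⟨j, hj, e⟩ := hPa
    refine ⟨j, hj, ?_⟩
    simp [sub_eq_zero] at e
    exact e.symm

theorem aux_scale (k : Type*) [Field k] [CharP k 5] (y z : k[X]) (c : k)
    (h : 2 * (y * derivative y) = (X ^ 5 - X) ^ 3)
    (hz : 2 * (z * derivative z) = (X ^ 5 - X) ^ 3) (e : y = C c * z) :
    y = z ∨ y = -z := by
  have hP0 : (X ^ 5 - X : k[X]) ≠ 0 := by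
    rw [← aux_prod k]
    exact Finset.prod_ne_zero_iff.2 fun j _ => X_sub_C_ne_zero _
  have h1 : (C c ^ 2 - 1) * (X ^ 5 - X : k[X]) ^ 3 = 0 := by
    rw [e, derivative_C_mul] at h
    linear_combination h - C c ^ 2 * hz
  have h2 := (mul_eq_zero.1 h1).resolve_right (pow_ne_zero _ hP0)
  have h3 : (C c - 1) * (C c + 1) = 0 := by linear_combination h2
  rcases mul_eq_zero.1 h3 with h4 | h4
  · left; linear_combination e + z * h4
  · right; linear_combination e + z * h4

theorem aux_main (k : Type*) [Field k] [CharP k 5] (y : k[X])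
    (h : 2 * (y * derivative y) = (X ^ 5 - X) ^ 3) :
    ∃ S ⊆ Finset.range 5, 4 ≤ S.card ∧ ∃ c : k, y = C c * (∏ j ∈ S, (X - C (j : k))) ^ 2 := by
  classical
  have hP0 : (X ^ 5 - X : k[X]) ≠ 0 := by
    rw [← aux_prod k]
    exact Finset.prod_ne_zero_iff.2 fun j _ => X_sub_C_ne_zero _
  have hne : 2 * (y * derivative y) ≠ 0 := by rw [h]; exact pow_ne_zero _ hP0
  have hne' := right_ne_zero_of_mul hne
  have hy0 := left_ne_zero_of_mul hne'
  have hy1 := right_ne_zero_of_mul hne'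
  have hdP : (X ^ 5 - X : k[X]).natDegree = 5 := by
    rw [← aux_prod k, natDegree_prod _ _ fun j _ => X_sub_C_ne_zero _]
    simp only [natDegree_X_sub_C]
    simp
  have hsp : y.Splits := by
    have hs : ((X ^ 5 - X : k[X]) ^ 3).Splits := by
      rw [← aux_prod k]
      exact (Splits.prod fun j _ => Splits.X_sub_C _).pow 3
    exact hs.of_dvd (pow_ne_zero _ hP0) ⟨2 * derivative y, by rw [← h]; ring⟩
  have hdeg : 8 ≤ y.natDegree := by
    have e := congrArg natDegree h
    have c2 : (2 : k[X]) = C 2 := (map_ofNat C 2).symm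
    rw [natDegree_mul (left_ne_zero_of_mul hne) hne', natDegree_mul hy0 hy1, natDegree_pow, hdP,
      c2, natDegree_C] at e
    have hlt : (derivative y).natDegree < y.natDegree := by
      apply natDegree_derivative_lt
      intro h0
      have := natDegree_derivative_le y
      omega
    omega
  let S : Finset ℕ := (Finset.range 5).filter fun j : ℕ => y.IsRoot (j : k)
  have hinj : Set.InjOn (fun j : ℕ => (j : k)) S := by
    intro a ha b hb hab
    have ha' : a < 5 := Finset.mem_range.1 (Finset.mem_filter.1 ha).1
    have hb' : b < 5 := Finset.mem_range.1 (Finset.mem_filter.1 hb).1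
    have := (CharP.cast_eq_iff_mod_eq k 5).1 hab
    rwa [Nat.mod_eq_of_lt ha', Nat.mod_eq_of_lt hb'] at this
  have hroots : y.roots = 2 • (S.image (fun j : ℕ => (j : k))).val := by
    ext a
    rw [count_roots, Multiset.count_nsmul, Multiset.count_eq_of_nodup (Finset.nodup _)]
    by_cases ha : y.IsRoot a
    · obtain ⟨h2, j, hj, rfl⟩ := aux_mult k y h a ha
      rw [h2, if_pos]
      exact Finset.mem_image.2 ⟨j, Finset.mem_filter.2 ⟨hj, ha⟩, rfl⟩
    · rw [rootMultiplicity_eq_zero ha, if_neg]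
      intro hm
      rw [Finset.mem_val] at hm
      obtain ⟨j, hj, rfl⟩ := Finset.mem_image.1 hm
      exact ha (Finset.mem_filter.1 hj).2
  refine ⟨S, Finset.filter_subset _ _, ?_, y.leadingCoeff, ?_⟩
  · have e := hsp.natDegree_eq_card_roots
    rw [hroots, Multiset.card_nsmul, Finset.card_val, Finset.card_image_of_injOn hinj] at e
    omega
  · have e := hsp.eq_prod_roots
    rw [hroots, Multiset.map_nsmul, Multiset.prod_nsmul] at e
    have e2 : (Multiset.map (fun a => X - C a) (S.image (fun j : ℕ => (j : k))).val).prod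
        = ∏ j ∈ S, (X - C (j : k)) := by
      change ∏ a ∈ S.image (fun j : ℕ => (j : k)), (X - C a) = _
      rw [Finset.prod_image hinj]
    rwa [e2] at e

theorem stmt_11 (k : Type*) [Field k] [CharP k 5] (y : k[X]) :
    (y.degree ≤ 10 ∧ 2 * (y * derivative y) = (X ^ 5 - X) ^ 3) ↔
    (y = (X ^ 5 - X) ^ 2 ∨ y = -((X ^ 5 - X) ^ 2) ∨
      ∃ i ∈ Finset.range 5,
        y = (∏ j ∈ (Finset.range 5).erase i, (X - C (j : k))) ^ 2 ∨
        y = -((∏ j ∈ (Finset.range 5).erase i, (X - C (j : k))) ^ 2)) := by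
  constructor
  · rintro ⟨-, h⟩
    obtain ⟨S, hS, hc, c, e⟩ := aux_main k y h
    have hle := Finset.card_le_card hS
    by_cases h5 : S = Finset.range 5
    · rw [h5, aux_prod] at e
      rcases aux_scale k y _ c h (aux_sol1 k) e with h' | h'
      · exact Or.inl h'
      · exact Or.inr (Or.inl h')
    · right; right
      obtain ⟨i, hi, hiS⟩ : ∃ i ∈ Finset.range 5, i ∉ S := by
        by_contra! hcon
        exact h5 (Finset.Subset.antisymm hS hcon)
      have hSe : S = (Finset.range 5).erase i := by
        apply Finset.eq_of_subset_of_card_le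
        · exact Finset.subset_erase.2 ⟨hS, hiS⟩
        · rw [Finset.card_erase_of_mem hi, Finset.card_range]; exact hc
      refine ⟨i, hi, ?_⟩
      rw [hSe] at e
      refine aux_scale k y _ c h ?_ e
      rw [aux_erase k i hi]
      exact aux_sol2 k i
  · rintro (rfl | rfl | ⟨i, hi, rfl | rfl⟩)
    · exact ⟨by compute_degree, aux_sol1 k⟩
    · refine ⟨by rw [degree_neg]; compute_degree, ?_⟩
      rw [derivative_neg, neg_mul_neg]; exact aux_sol1 k
    · rw [aux_erase k i hi]
      exact ⟨le_trans (b := ((8 : ℕ) : WithBot ℕ)) (by compute_degree; exact le_rfl) (by norm_num), aux_sol2 k i⟩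
    · rw [aux_erase k i hi, derivative_neg, neg_mul_neg, degree_neg]
      exact ⟨le_trans (b := ((8 : ℕ) : WithBot ℕ)) (by compute_degree; exact le_rfl) (by norm_num), aux_sol2 k i⟩
end

section
/- Let K be a field of characteristic 5 and b ∈ K. Then the polynomial y^2 − x^5 − b^5 generates a prime ideal in the polynomial ring K[x,y], and the fraction field of the quotient ring K[x,y]/(y^2 − x^5 − b^5) is isomorphic as a K-algebra to the field K(u) of rational functions in one variable over K. -/
open MvPolynomial

noncomputable def stmtHom (K : Type*) [Field K] (b : K) :
    MvPolynomial (Fin 2) K →ₐ[K] Polynomial K :=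
  aeval ![Polynomial.X ^ 2 - Polynomial.C b, Polynomial.X ^ 5]

theorem stmt_reduce (K : Type*) [Field K] (b : K) (p : MvPolynomial (Fin 2) K) :
    ∃ A B : Polynomial K, p - (Polynomial.aeval (X 0) A + X 1 * Polynomial.aeval (X 0) B) ∈
      Ideal.span {(X 1 ^ 2 - X 0 ^ 5 - C (b ^ 5) : MvPolynomial (Fin 2) K)} := by
  induction p using MvPolynomial.induction_on with
  | C a =>
    refine ⟨Polynomial.C a, 0, ?_⟩
    simp [MvPolynomial.algebraMap_eq]
  | add p q hp hq =>
    obtain ⟨A, B, h⟩ := hp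
    obtain ⟨A', B', h'⟩ := hq
    refine ⟨A + A', B + B', ?_⟩
    have := Ideal.add_mem _ h h'
    convert this using 1
    simp only [map_add]
    ring
  | mul_X p i hp =>
    obtain ⟨A, B, h⟩ := hp
    rw [Ideal.mem_span_singleton] at h
    obtain ⟨c, hc⟩ := h
    fin_cases i
    · refine ⟨A * Polynomial.X, B * Polynomial.X, ?_⟩
      rw [Ideal.mem_span_singleton]
      refine ⟨c * X 0, ?_⟩
      simp only [map_mul, Polynomial.aeval_X, Fin.zero_eta]
      linear_combination (X 0) * hc
    · refine ⟨B * (Polynomial.X ^ 5 + Polynomial.C (b ^ 5)), A, ?_⟩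
      rw [Ideal.mem_span_singleton]
      refine ⟨c * X 1 + Polynomial.aeval (X 0) B, ?_⟩
      simp only [map_mul, map_add, map_pow, Polynomial.aeval_X, Polynomial.aeval_C,
        MvPolynomial.algebraMap_eq, Fin.mk_one] at hc ⊢
      linear_combination (X 1) * hc

theorem stmt_gen (K : Type*) [Field K] [CharP K 5] (b : K) :
    stmtHom K b (X 1 ^ 2 - X 0 ^ 5 - C (b ^ 5)) = 0 := by
  have : Fact (Nat.Prime 5) := ⟨by norm_num⟩
  have h : (Polynomial.X ^ 2 - Polynomial.C b) ^ 5
      = (Polynomial.X ^ 2) ^ 5 - (Polynomial.C b : Polynomial K) ^ 5 := sub_pow_char _ _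
  simp only [stmtHom, map_sub, map_pow, aeval_X, algHom_C, Polynomial.algebraMap_eq,
    Matrix.cons_val_zero, Matrix.cons_val_one]
  rw [h]
  ring

theorem stmt_ker (K : Type*) [Field K] [CharP K 5] (b : K) :
    RingHom.ker (stmtHom K b) =
      Ideal.span {(X 1 ^ 2 - X 0 ^ 5 - C (b ^ 5) : MvPolynomial (Fin 2) K)} := by
  have hle : Ideal.span {(X 1 ^ 2 - X 0 ^ 5 - C (b ^ 5) : MvPolynomial (Fin 2) K)} ≤
      RingHom.ker (stmtHom K b) := by
    rw [Ideal.span_singleton_le_iff_mem, RingHom.mem_ker]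
    exact stmt_gen K b
  refine le_antisymm ?_ hle
  intro p hp
  obtain ⟨A, B, h⟩ := stmt_reduce K b p
  have h2 := hle h
  rw [RingHom.mem_ker] at hp h2
  have hc : ∀ A : Polynomial K, stmtHom K b (Polynomial.aeval (X 0) A)
      = A.comp (Polynomial.X ^ 2 - Polynomial.C b) := by
    intro A
    rw [← Polynomial.aeval_algHom_apply, Polynomial.comp, Polynomial.aeval_def, Polynomial.algebraMap_eq]
    simp [stmtHom]
  have hd : (Polynomial.X ^ 2 - Polynomial.C b).natDegree = 2 := by
    simp
  have hz : ∀ A : Polynomial K, A.comp (Polynomial.X ^ 2 - Polynomial.C b) = 0 → A = 0 := by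
    intro A hA
    rcases Polynomial.comp_eq_zero_iff.mp hA with h | ⟨_, h⟩
    · exact h
    · have := congrArg Polynomial.natDegree h
      rw [hd] at this
      simp at this
  have h1 : stmtHom K b (X 1) = Polynomial.X ^ 5 := by simp [stmtHom]
  rw [map_sub, hp, map_add, map_mul, hc, hc, h1, zero_sub, neg_eq_zero] at h2
  have hB : B = 0 := by
    by_contra hB
    have hB' := fun h => hB (hz B h)
    have := congrArg Polynomial.natDegree (eq_neg_of_add_eq_zero_left h2)
    rw [Polynomial.natDegree_neg, Polynomial.natDegree_mul (by simp) hB',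
      Polynomial.natDegree_comp, Polynomial.natDegree_comp, hd, Polynomial.natDegree_X_pow] at this
    omega
  subst hB
  have hA : A = 0 := hz A (by simpa using h2)
  subst hA
  simpa using h

theorem stmt_12 (K : Type*) [Field K] [CharP K 5] (b : K) :
    (Ideal.span {(X 1 ^ 2 - X 0 ^ 5 - C (b ^ 5) : MvPolynomial (Fin 2) K)}).IsPrime ∧
    Nonempty ((FractionRing (MvPolynomial (Fin 2) K ⧸
        Ideal.span {(X 1 ^ 2 - X 0 ^ 5 - C (b ^ 5) : MvPolynomial (Fin 2) K)}))
      ≃ₐ[K] RatFunc K) := by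
  have hker := stmt_ker K b
  generalize Ideal.span {(X 1 ^ 2 - X 0 ^ 5 - C (b ^ 5) : MvPolynomial (Fin 2) K)} = I at hker ⊢
  subst hker
  have hp : (RingHom.ker (stmtHom K b)).IsPrime := RingHom.ker_isPrime _
  refine ⟨hp, ?_⟩
  let g : (MvPolynomial (Fin 2) K ⧸ RingHom.ker (stmtHom K b)) →ₐ[K] RatFunc K :=
    (IsScalarTower.toAlgHom K (Polynomial K) (RatFunc K)).comp
      (Ideal.kerLiftAlg (stmtHom K b))
  have hg : Function.Injective g :=
    (IsFractionRing.injective (Polynomial K) (RatFunc K)).comp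
      (Ideal.kerLiftAlg_injective (stmtHom K b))
  let f : FractionRing (MvPolynomial (Fin 2) K ⧸ RingHom.ker (stmtHom K b)) →ₐ[K] RatFunc K :=
    IsFractionRing.liftAlgHom (g := g) hg
  have hf : ∀ p : MvPolynomial (Fin 2) K, f (algebraMap (MvPolynomial (Fin 2) K ⧸ RingHom.ker (stmtHom K b)) _ (Ideal.Quotient.mk (RingHom.ker (stmtHom K b)) p))
      = algebraMap (Polynomial K) (RatFunc K) (stmtHom K b p) := by
    intro p
    exact IsFractionRing.lift_algebraMap hg _
  obtain ⟨w, hw⟩ : ∃ w, f w = RatFunc.X := by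
    refine ⟨algebraMap (MvPolynomial (Fin 2) K ⧸ RingHom.ker (stmtHom K b)) _ (Ideal.Quotient.mk (RingHom.ker (stmtHom K b)) (X 1)) /
      (algebraMap (MvPolynomial (Fin 2) K ⧸ RingHom.ker (stmtHom K b)) _ (Ideal.Quotient.mk (RingHom.ker (stmtHom K b)) (X 0 + C b))) ^ 2, ?_⟩
    rw [map_div₀, map_pow, hf, hf]
    have h1 : stmtHom K b (X 1) = Polynomial.X ^ 5 := by simp [stmtHom]
    have h0 : stmtHom K b (X 0 + C b) = Polynomial.X ^ 2 := by
      simp [stmtHom, Polynomial.algebraMap_eq]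
    rw [h1, h0, map_pow, map_pow, RatFunc.algebraMap_X]
    have := RatFunc.X_ne_zero (K := K)
    field_simp
  have hpoly : ∀ p : Polynomial K, f (Polynomial.aeval w p) = algebraMap _ _ p := by
    intro p
    rw [← Polynomial.aeval_algHom_apply, hw, ← RatFunc.algebraMap_X,
      Polynomial.aeval_algebraMap_apply, Polynomial.aeval_X_left_apply]
  refine ⟨AlgEquiv.ofBijective f ⟨f.toRingHom.injective, ?_⟩⟩
  intro r
  refine ⟨Polynomial.aeval w r.num / Polynomial.aeval w r.denom, ?_⟩
  rw [map_div₀, hpoly, hpoly, RatFunc.num_div_denom]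
end

section
/- Let k be a perfect field of characteristic 5 and let φ ∈ k[t] be any polynomial. Then the polynomial y^2 − x^5 − φ(t) generates a prime ideal in the polynomial ring k[t,x,y], and there exists a k-algebra embedding of the fraction field of k[t,x,y]/(y^2 − x^5 − φ(t)) into the field k(s,u) of rational functions in two variables over k, sending t to s^5. -/
open MvPolynomial

theorem exists_fifth_root (k : Type*) [Field k] [CharP k 5] [PerfectField k]
    (φ : Polynomial k) : ∃ ψ : Polynomial k, ψ ^ 5 = Polynomial.expand k 5 φ := by
  have : Fact (Nat.Prime 5) := ⟨by norm_num⟩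
  have : PerfectRing k 5 := PerfectField.toPerfectRing 5
  refine ⟨φ.map ((frobeniusEquiv k 5).symm : k →+* k), ?_⟩
  rw [← Polynomial.map_frobenius_expand 5, Polynomial.map_expand, Polynomial.map_map]
  have : (frobenius k 5).comp ((frobeniusEquiv k 5).symm : k →+* k) = RingHom.id k := by
    ext a
    exact frobenius_apply_frobeniusEquiv_symm k 5 a
  rw [this, Polynomial.map_id]

/-- the map `t ↦ s^5, x ↦ u^2 - ψ(s)` -/
noncomputable def gmap (k : Type*) [Field k] (ψ : Polynomial k) :
    MvPolynomial (Fin 2) k →ₐ[k] MvPolynomial (Fin 2) k :=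
  aeval ![X 0 ^ 5, X 1 ^ 2 - Polynomial.aeval (X 0) ψ]

/-- the map `t ↦ s^5, x ↦ u^2 - ψ(s), y ↦ u^5` -/
noncomputable def hmap (k : Type*) [Field k] (ψ : Polynomial k) :
    MvPolynomial (Fin 3) k →ₐ[k] MvPolynomial (Fin 2) k :=
  aeval ![X 0 ^ 5, X 1 ^ 2 - Polynomial.aeval (X 0) ψ, X 1 ^ 5]

theorem gmap_inj (k : Type*) [Field k] (ψ : Polynomial k) :
    Function.Injective (gmap k ψ) := by
  let d : MvPolynomial (Fin 2) k →ₐ[k] MvPolynomial (Fin 2) k := aeval ![X 0 ^ 5, X 1]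
  let d' : MvPolynomial (Fin 2) k →ₐ[k] MvPolynomial (Fin 2) k := aeval ![X 0, X 1 ^ 5]
  let e : MvPolynomial (Fin 2) k →ₐ[k] MvPolynomial (Fin 2) k := aeval ![X 0, X 1 ^ 2]
  let e' : MvPolynomial (Fin 2) k →ₐ[k] MvPolynomial (Fin 2) k := aeval ![X 0 ^ 2, X 1]
  let τ : MvPolynomial (Fin 2) k →ₐ[k] MvPolynomial (Fin 2) k :=
    aeval ![X 0, X 1 - Polynomial.aeval (X 0) ψ]
  let τ' : MvPolynomial (Fin 2) k →ₐ[k] MvPolynomial (Fin 2) k :=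
    aeval ![X 0, X 1 + Polynomial.aeval (X 0) ψ]
  have hd : d'.comp d = expand 5 := by
    ext i : 1
    fin_cases i <;> simp [d, d']
  have he : e'.comp e = expand 2 := by
    ext i : 1
    fin_cases i <;> simp [e, e']
  have hτ : τ'.comp τ = AlgHom.id k _ := by
    ext i : 1
    fin_cases i <;> simp [τ, τ', ← Polynomial.aeval_algHom_apply]
  have hg : gmap k ψ = e.comp (τ.comp d) := by
    ext i : 1
    fin_cases i <;> simp [gmap, e, τ, d, ← Polynomial.aeval_algHom_apply]
  have di : Function.Injective d := by
    apply Function.Injective.of_comp (f := d')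
    rw [← AlgHom.coe_comp, hd]
    exact expand_injective (by norm_num)
  have ei : Function.Injective e := by
    apply Function.Injective.of_comp (f := e')
    rw [← AlgHom.coe_comp, he]
    exact expand_injective (by norm_num)
  have τi : Function.Injective τ := by
    apply Function.Injective.of_comp (f := τ')
    rw [← AlgHom.coe_comp, hτ]
    exact Function.injective_id
  rw [hg]
  exact ei.comp (τi.comp di)

theorem hmap_rename (k : Type*) [Field k] (ψ : Polynomial k) (a : MvPolynomial (Fin 2) k) :
    hmap k ψ (rename Fin.castSucc a) = gmap k ψ a := by
  rw [hmap, gmap, aeval_rename]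
  congr 2
  ext i : 1
  fin_cases i <;> rfl

theorem indep (k : Type*) [Field k] [CharP k 5] (ψ : Polynomial k)
    (a b : MvPolynomial (Fin 2) k) (h : gmap k ψ a + gmap k ψ b * X 1 ^ 5 = 0) :
    a = 0 ∧ b = 0 := by
  let σ : MvPolynomial (Fin 2) k →ₐ[k] MvPolynomial (Fin 2) k := aeval ![X 0, - X 1]
  have hσ : ∀ c, σ (gmap k ψ c) = gmap k ψ c := by
    intro c
    have : σ.comp (gmap k ψ) = gmap k ψ := by
      ext i : 1
      fin_cases i <;> simp [gmap, σ, ← Polynomial.aeval_algHom_apply]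
    exact DFunLike.congr_fun this c
  have h2 := congrArg σ h
  have hX : σ (X 1) = - X 1 := by simp [σ]
  rw [map_add, map_mul, map_pow, hσ, hσ, hX, map_zero] at h2
  have h20 : (2 : MvPolynomial (Fin 2) k) ≠ 0 := by
    intro h
    have := (CharP.cast_eq_zero_iff (MvPolynomial (Fin 2) k) 5 2).1 (by exact_mod_cast h)
    omega
  have ha : gmap k ψ a = 0 := by
    have : 2 * gmap k ψ a = 0 := by linear_combination h + h2
    exact (mul_eq_zero.1 this).resolve_left h20
  have hb : gmap k ψ b = 0 := by
    rw [ha, zero_add] at h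
    exact (mul_eq_zero.1 h).resolve_right (pow_ne_zero _ (X_ne_zero _))
  exact ⟨gmap_inj k ψ (by rw [ha, map_zero]), gmap_inj k ψ (by rw [hb, map_zero])⟩

theorem normal_form (k : Type*) [Field k] (φ : Polynomial k) (p : MvPolynomial (Fin 3) k) :
    ∃ a b : MvPolynomial (Fin 2) k, ∃ q : MvPolynomial (Fin 3) k,
      p = q * (X 2 ^ 2 - X 1 ^ 5 - Polynomial.aeval (X 0) φ) +
        rename Fin.castSucc a + rename Fin.castSucc b * X 2 := by
  induction p using MvPolynomial.induction_on with
  | C c => exact ⟨C c, 0, 0, by simp⟩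
  | add p q hp hq =>
    obtain ⟨a, b, r, hp⟩ := hp
    obtain ⟨a', b', r', hq⟩ := hq
    refine ⟨a + a', b + b', r + r', ?_⟩
    simp only [map_add]
    linear_combination hp + hq
  | mul_X p i hp =>
    obtain ⟨a, b, r, hp⟩ := hp
    have h0 : rename (R := k) (Fin.castSucc : Fin 2 → Fin 3) (X 0) = X 0 := by simp
    have h1 : rename (R := k) (Fin.castSucc : Fin 2 → Fin 3) (X 1) = X 1 := by simp
    have hφ : rename (R := k) (Fin.castSucc : Fin 2 → Fin 3) (Polynomial.aeval (X 0) φ) =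
        Polynomial.aeval (X 0) φ := by
      rw [← Polynomial.aeval_algHom_apply, h0]
    fin_cases i
    · refine ⟨a * X 0, b * X 0, r * X 0, ?_⟩
      simp only [map_mul, h0]
      change p * X 0 = _
      linear_combination X 0 * hp
    · refine ⟨a * X 1, b * X 1, r * X 1, ?_⟩
      simp only [map_mul, h1]
      change p * X 1 = _
      linear_combination X 1 * hp
    · refine ⟨b * (X 1 ^ 5 + Polynomial.aeval (X 0) φ), a,
        r * X 2 + rename Fin.castSucc b, ?_⟩
      simp only [map_mul, map_add, map_pow, h1, hφ]
      change p * X 2 = _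
      linear_combination X 2 * hp

theorem ker_hmap (k : Type*) [Field k] [CharP k 5] (φ ψ : Polynomial k)
    (hψ : ψ ^ 5 = Polynomial.expand k 5 φ) :
    RingHom.ker (hmap k ψ) =
      Ideal.span {(X 2 ^ 2 - X 1 ^ 5 - Polynomial.aeval (X 0) φ : MvPolynomial (Fin 3) k)} := by
  have : Fact (Nat.Prime 5) := ⟨by norm_num⟩
  have hf : hmap k ψ (X 2 ^ 2 - X 1 ^ 5 - Polynomial.aeval (X 0) φ) = 0 := by
    have e1 : Polynomial.aeval (X 0 ^ 5 : MvPolynomial (Fin 2) k) φ =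
        (Polynomial.aeval (X 0) ψ) ^ 5 := by
      rw [← map_pow, hψ, Polynomial.expand_aeval]
    have h0 : hmap k ψ (X 0) = X 0 ^ 5 := by simp [hmap]
    have h1 : hmap k ψ (X 1) = X 1 ^ 2 - Polynomial.aeval (X 0) ψ := by simp [hmap]
    have h2 : hmap k ψ (X 2) = X 1 ^ 5 := by simp [hmap]
    rw [map_sub, map_sub, map_pow, map_pow, ← Polynomial.aeval_algHom_apply, h0, h1, h2, e1,
      sub_pow_char]
    ring
  apply le_antisymm
  · intro p hp
    obtain ⟨a, b, q, rfl⟩ := normal_form k φ p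
    rw [RingHom.mem_ker, map_add, map_add, map_mul, map_mul, hf, hmap_rename, hmap_rename,
      mul_zero, zero_add] at hp
    have h2 : hmap k ψ (X 2) = X 1 ^ 5 := by simp [hmap]
    rw [h2] at hp
    obtain ⟨rfl, rfl⟩ := indep k ψ a b hp
    rw [Ideal.mem_span_singleton']
    exact ⟨q, by simp⟩
  · rw [Ideal.span_singleton_le_iff_mem]
    exact hf

theorem stmt_13 (k : Type*) [Field k] [CharP k 5] [PerfectField k]
    (φ : Polynomial k) :
    (Ideal.span {(X 2 ^ 2 - X 1 ^ 5 - Polynomial.aeval (X 0) φ :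
        MvPolynomial (Fin 3) k)}).IsPrime ∧
    ∃ F : (FractionRing (MvPolynomial (Fin 3) k ⧸
          Ideal.span {(X 2 ^ 2 - X 1 ^ 5 - Polynomial.aeval (X 0) φ :
            MvPolynomial (Fin 3) k)}))
        →ₐ[k] FractionRing (MvPolynomial (Fin 2) k),
      Function.Injective F ∧
      F (algebraMap
          (MvPolynomial (Fin 3) k ⧸
            Ideal.span {(X 2 ^ 2 - X 1 ^ 5 - Polynomial.aeval (X 0) φ :
              MvPolynomial (Fin 3) k)}) _
          (Ideal.Quotient.mk _ (X 0 : MvPolynomial (Fin 3) k))) =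
        (algebraMap (MvPolynomial (Fin 2) k) _ (X 0)) ^ 5 := by
  obtain ⟨ψ, hψ⟩ := exists_fifth_root k φ
  have hk := ker_hmap k φ ψ hψ
  generalize Ideal.span {(X 2 ^ 2 - X 1 ^ 5 - Polynomial.aeval (X 0) φ :
        MvPolynomial (Fin 3) k)} = I at hk ⊢
  subst hk
  have hp : (RingHom.ker (hmap k ψ)).IsPrime := RingHom.ker_isPrime _
  refine ⟨hp, ?_⟩
  let j : (MvPolynomial (Fin 3) k ⧸ RingHom.ker (hmap k ψ)) →ₐ[k]
      FractionRing (MvPolynomial (Fin 2) k) :=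
    (IsScalarTower.toAlgHom k (MvPolynomial (Fin 2) k) _).comp (Ideal.kerLiftAlg (hmap k ψ))
  have hj : Function.Injective j :=
    (IsFractionRing.injective (MvPolynomial (Fin 2) k) _).comp
      (Ideal.kerLiftAlg_injective (hmap k ψ))
  refine ⟨IsFractionRing.liftAlgHom (g := j) hj, RingHom.injective _, ?_⟩
  have h0 : hmap k ψ (X 0) = X 0 ^ 5 := by simp [hmap]
  rw [IsFractionRing.liftAlgHom_apply, IsFractionRing.lift_algebraMap, ← map_pow, ← h0]
  rfl
end
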